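/- Let q̃ be a probability measure on ℝ with finite second moment and variance σ²_{q̃} (this is the EP variance estimate σ²_EP). Let σ²_QP = (√2 ∫₀¹ F_{q̃}⁻¹(y) erf⁻¹(2y−1) dy)² be the QP variance estimate. Then the minimal squared L₂ Wasserstein distance from q̃ to a Gaussian with mean μ_{q̃} satisfies W₂²(q̃, N(μ_{q̃}, σ²_QP)) = σ²_EP − σ²_QP. -/

import Mathlib

open MeasureTheory ProbabilityTheory Set

/-- `Wpp p ξ ν` : the `p`-th power of the `L_p` Wasserstein distance, as the infimum
over couplings `π` of `ξ` and `ν` of `∫ |x - z|^p dπ(x, z)`. -/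
noncomputable def Wpp (p : ℝ) (ξ ν : Measure ℝ) : ℝ :=
  sInf {c : ℝ | ∃ π : Measure (ℝ × ℝ), IsProbabilityMeasure π ∧
    π.map Prod.fst = ξ ∧ π.map Prod.snd = ν ∧ c = ∫ z, |z.1 - z.2| ^ p ∂π}

/-- Quantile function: `F⁻¹(y) = inf {x : F(x) ≥ y}` where `F(x) = ξ((-∞, x])`. -/
noncomputable def quantile (ξ : Measure ℝ) (y : ℝ) : ℝ :=
  sInf {x : ℝ | y ≤ (ξ (Iic x)).toReal}

/-- The error function `erf(x) = (2/√π) ∫₀ˣ e^{-t²} dt`. -/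
noncomputable def erf (x : ℝ) : ℝ :=
  (2 / Real.sqrt Real.pi) * ∫ t in (0:ℝ)..x, Real.exp (-t ^ 2)

/-- The inverse error function. -/
noncomputable def erfinv : ℝ → ℝ := Function.invFun erf

noncomputable def kk (x s : ℝ) : ℝ :=
  (Ioi s).indicator (fun _ => (1:ℝ)) x - (Ioi s).indicator (fun _ => (1:ℝ)) 0

lemma kk_meas : Measurable (fun p : ℝ × ℝ => kk p.1 p.2) := by
  have : (fun p : ℝ × ℝ => kk p.1 p.2) = fun p =>
      ({p : ℝ × ℝ | p.2 < p.1}.indicator (fun _ => (1:ℝ)) p) -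
      ({p : ℝ × ℝ | p.2 < 0}.indicator (fun _ => (1:ℝ)) p) := by
    funext p; simp [kk, indicator]
  rw [this]
  exact (measurable_const.indicator (measurableSet_lt measurable_snd measurable_fst)).sub
    (measurable_const.indicator (measurableSet_lt measurable_snd measurable_const))

lemma kk_eq (x : ℝ) : kk x = fun s => (Ico 0 x).indicator (fun _ => (1:ℝ)) s -
    (Ico x 0).indicator (fun _ => (1:ℝ)) s := by
  funext s
  simp only [kk, indicator, mem_Ioi, mem_Ico]
  split_ifs <;> first | (norm_num; done) | (exfalso; grind)

lemma kk_abs (x : ℝ) : (fun s => ‖kk x s‖) = fun s => (Ico 0 x).indicator (fun _ => (1:ℝ)) s +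
    (Ico x 0).indicator (fun _ => (1:ℝ)) s := by
  funext s
  simp only [kk, indicator, mem_Ioi, mem_Ico]
  split_ifs <;> first | (norm_num; done) | (exfalso; grind)

lemma ind_int (a b : ℝ) : Integrable ((Ico a b).indicator (fun _ => (1:ℝ))) := by
  rw [integrable_indicator_iff measurableSet_Ico]
  exact integrableOn_const (by simp)

lemma kk_int (x : ℝ) : Integrable (kk x) := by
  rw [kk_eq]; exact (ind_int _ _).sub (ind_int _ _)

lemma kk_integral (x : ℝ) : ∫ s, kk x s = x := by
  rw [kk_eq, integral_sub (ind_int _ _) (ind_int _ _), integral_indicator measurableSet_Ico,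
    integral_indicator measurableSet_Ico]
  simp
  

lemma kk_norm (x : ℝ) : ∫ s, ‖kk x s‖ = |x| := by
  rw [kk_abs, integral_add (ind_int _ _) (ind_int _ _), integral_indicator measurableSet_Ico,
    integral_indicator measurableSet_Ico]
  simp
  

lemma kk_prod_int (π : Measure (ℝ × ℝ)) [IsProbabilityMeasure π]
    (hi : Integrable (fun p => p.1 * p.2) π) :
    Integrable (Function.uncurry (fun (p q : ℝ × ℝ) => kk p.1 q.1 * kk p.2 q.2))
      (π.prod (volume.prod volume)) := by
  have hm : Measurable (Function.uncurry (fun (p q : ℝ × ℝ) => kk p.1 q.1 * kk p.2 q.2)) := by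
    refine Measurable.mul
      (f := fun r : (ℝ × ℝ) × (ℝ × ℝ) => kk r.1.1 r.2.1)
      (g := fun r : (ℝ × ℝ) × (ℝ × ℝ) => kk r.1.2 r.2.2) ?_ ?_
    · exact kk_meas.comp (f := fun r : (ℝ × ℝ) × (ℝ × ℝ) => (r.1.1, r.2.1)) (by fun_prop)
    · exact kk_meas.comp (f := fun r : (ℝ × ℝ) × (ℝ × ℝ) => (r.1.2, r.2.2)) (by fun_prop)
  rw [integrable_prod_iff hm.aestronglyMeasurable]
  refine ⟨Filter.Eventually.of_forall fun p => (kk_int p.1).mul_prod (kk_int p.2), ?_⟩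
  refine hi.norm.congr (Filter.Eventually.of_forall fun p => ?_)
  simp only [Function.uncurry, norm_mul]
  rw [integral_prod_mul (fun s => ‖kk p.1 s‖) (fun s => ‖kk p.2 s‖), kk_norm, kk_norm]
  simp

lemma hoeff (π : Measure (ℝ × ℝ)) [IsProbabilityMeasure π]
    (hi : Integrable (fun p => p.1 * p.2) π) :
    ∫ p, p.1 * p.2 ∂π = ∫ q : ℝ × ℝ, (∫ p, kk p.1 q.1 * kk p.2 q.2 ∂π) ∂(volume.prod volume) := by
  rw [← integral_integral_swap (kk_prod_int π hi)]
  refine integral_congr_ae (Filter.Eventually.of_forall fun p => ?_)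
  simp only
  rw [integral_prod_mul (fun s => kk p.1 s) (fun s => kk p.2 s), kk_integral, kk_integral]

lemma kk_formula (π : Measure (ℝ × ℝ)) [IsProbabilityMeasure π] (ξ ν : Measure ℝ)
    (h1 : π.map Prod.fst = ξ) (h2 : π.map Prod.snd = ν) (s t : ℝ) :
    ∫ p, kk p.1 s * kk p.2 t ∂π = π.real (Ioi s ×ˢ Ioi t)
      - (Ioi t).indicator (fun _ => (1:ℝ)) 0 * ξ.real (Ioi s)
      - (Ioi s).indicator (fun _ => (1:ℝ)) 0 * ν.real (Ioi t)
      + (Ioi s).indicator (fun _ => (1:ℝ)) 0 * (Ioi t).indicator (fun _ => (1:ℝ)) 0 := by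
  set a := (Ioi s).indicator (fun _ => (1:ℝ)) 0
  set b := (Ioi t).indicator (fun _ => (1:ℝ)) 0
  have e : ∀ p : ℝ × ℝ, kk p.1 s * kk p.2 t =
      (Ioi s ×ˢ Ioi t).indicator (fun _ => (1:ℝ)) p
      - b * (Prod.fst ⁻¹' Ioi s).indicator (fun _ => (1:ℝ)) p
      - a * (Prod.snd ⁻¹' Ioi t).indicator (fun _ => (1:ℝ)) p + a * b := by
    intro p
    have : (Ioi s ×ˢ Ioi t).indicator (fun _ => (1:ℝ)) p =
      (Ioi s).indicator (fun _ => (1:ℝ)) p.1 * (Ioi t).indicator (fun _ => (1:ℝ)) p.2 := by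
      simp only [indicator, mem_prod]
      split_ifs <;> grind
    rw [this]
    change ((Ioi s).indicator (fun _ => (1:ℝ)) p.1 - a) *
      ((Ioi t).indicator (fun _ => (1:ℝ)) p.2 - b) = _ -
      b * (Ioi s).indicator (fun _ => (1:ℝ)) p.1 - a * (Ioi t).indicator (fun _ => (1:ℝ)) p.2 + _
    ring
  have hI : ∀ S : Set (ℝ × ℝ), MeasurableSet S →
      Integrable (S.indicator (fun _ => (1:ℝ))) π := fun S hS =>
    (integrable_const 1).indicator hS
  have m1 : MeasurableSet (Prod.fst ⁻¹' Ioi s : Set (ℝ × ℝ)) := measurable_fst measurableSet_Ioi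
  have m2 : MeasurableSet (Prod.snd ⁻¹' Ioi t : Set (ℝ × ℝ)) := measurable_snd measurableSet_Ioi
  have m3 : MeasurableSet (Ioi s ×ˢ Ioi t) := measurableSet_Ioi.prod measurableSet_Ioi
  have i1 : Integrable (fun p => (Ioi s ×ˢ Ioi t).indicator (fun _ => (1:ℝ)) p
      - b * (Prod.fst ⁻¹' Ioi s).indicator (fun _ => (1:ℝ)) p) π :=
    (hI _ m3).sub ((hI _ m1).const_mul b)
  have i2 : Integrable (fun p => (Ioi s ×ˢ Ioi t).indicator (fun _ => (1:ℝ)) p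
      - b * (Prod.fst ⁻¹' Ioi s).indicator (fun _ => (1:ℝ)) p
      - a * (Prod.snd ⁻¹' Ioi t).indicator (fun _ => (1:ℝ)) p) π :=
    i1.sub ((hI _ m2).const_mul a)
  simp_rw [e]
  rw [integral_add i2
    (integrable_const _), integral_sub i1
    ((hI _ m2).const_mul a), integral_sub (hI _ m3) ((hI _ m1).const_mul b),
    integral_const_mul, integral_const_mul, integral_indicator_const _ m1,
    integral_indicator_const _ m2, integral_indicator_const _ m3, ← h1, ← h2,
    map_measureReal_apply measurable_fst measurableSet_Ioi,
    map_measureReal_apply measurable_snd measurableSet_Ioi]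
  simp

lemma hoeff_mono (π π' : Measure (ℝ × ℝ)) [IsProbabilityMeasure π] [IsProbabilityMeasure π']
    (ξ ν : Measure ℝ)
    (h1 : π.map Prod.fst = ξ) (h2 : π.map Prod.snd = ν)
    (h1' : π'.map Prod.fst = ξ) (h2' : π'.map Prod.snd = ν)
    (hi : Integrable (fun p => p.1 * p.2) π) (hi' : Integrable (fun p => p.1 * p.2) π')
    (hle : ∀ s t, π.real (Ioi s ×ˢ Ioi t) ≤ π'.real (Ioi s ×ˢ Ioi t)) :
    ∫ p, p.1 * p.2 ∂π ≤ ∫ p, p.1 * p.2 ∂π' := by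
  rw [hoeff π hi, hoeff π' hi']
  refine integral_mono (kk_prod_int π hi).integral_prod_right
    (kk_prod_int π' hi').integral_prod_right fun q => ?_
  simp only
  rw [kk_formula π ξ ν h1 h2, kk_formula π' ξ ν h1' h2']
  linarith [hle q.1 q.2]

noncomputable def UU : Measure ℝ := volume.restrict (Ioo 0 1)

instance : IsProbabilityMeasure UU := ⟨by simp [UU]⟩

def Gal (f : ℝ → ℝ) (ν : Measure ℝ) : Prop :=
  ∀ y ∈ Ioo (0:ℝ) 1, ∀ x, f y ≤ x ↔ y ≤ ν.real (Iic x)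

lemma Gal.aem {f : ℝ → ℝ} {ν : Measure ℝ} (h : Gal f ν) : AEMeasurable f UU := by
  refine aemeasurable_restrict_of_monotoneOn measurableSet_Ioo fun a ha b hb hab => ?_
  rw [h a ha]
  exact hab.trans ((h b hb _).1 le_rfl)

lemma UU_gt (c : ℝ) (h0 : 0 ≤ c) (h1 : c ≤ 1) : UU.real (Ioi c) = 1 - c := by
  have : Ioi c ∩ Ioo 0 1 = Ioo c 1 := by
    ext x; simp; grind
  simp [UU, measureReal_restrict_apply measurableSet_Ioi, this, h1]

lemma UU_congr {A B : Set ℝ} (h : ∀ y ∈ Ioo (0:ℝ) 1, y ∈ A ↔ y ∈ B) : UU.real A = UU.real B := by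
  apply measureReal_congr
  filter_upwards [ae_restrict_mem measurableSet_Ioo] with y hy
  exact propext (h y hy)

lemma Gal.map {f : ℝ → ℝ} {ν : Measure ℝ} [IsProbabilityMeasure ν] (h : Gal f ν) :
    UU.map f = ν := by
  have : IsProbabilityMeasure (UU.map f) := Measure.isProbabilityMeasure_map h.aem
  refine Measure.ext_of_Iic _ _ fun x => ?_
  rw [← measureReal_eq_measureReal_iff]
  rw [map_measureReal_apply_of_aemeasurable h.aem measurableSet_Iic]
  have e : UU.real (f ⁻¹' Iic x) = UU.real (Ioi (ν.real (Iic x)))ᶜ :=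
    UU_congr fun y hy => by simpa using h y hy x
  rw [e, measureReal_compl measurableSet_Ioi, UU_gt _ measureReal_nonneg measureReal_le_one]
  simp

lemma comono {f g : ℝ → ℝ} {ξ ν : Measure ℝ} [IsProbabilityMeasure ξ] [IsProbabilityMeasure ν]
    (hf : Gal f ξ) (hg : Gal g ν) (π : Measure (ℝ × ℝ)) [IsProbabilityMeasure π]
    (h1 : π.map Prod.fst = ξ) (h2 : π.map Prod.snd = ν)
    (hξ : MemLp id 2 ξ) (hν : MemLp id 2 ν) :
    ∫ p, p.1 * p.2 ∂π ≤ ∫ y, f y * g y ∂UU := by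
  have hm : AEMeasurable (fun y => (f y, g y)) UU := hf.aem.prodMk hg.aem
  have : IsProbabilityMeasure (UU.map (fun y => (f y, g y))) := Measure.isProbabilityMeasure_map hm
  have key : ∀ π : Measure (ℝ × ℝ), π.map Prod.fst = ξ → π.map Prod.snd = ν →
      Integrable (fun p => p.1 * p.2) π := by
    intro π h1 h2
    rw [← h1, memLp_map_measure_iff (by fun_prop) (by fun_prop)] at hξ
    rw [← h2, memLp_map_measure_iff (by fun_prop) (by fun_prop)] at hν
    exact hξ.integrable_mul hν
  have e1 : (UU.map (fun y => (f y, g y))).map Prod.fst = ξ := by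
    rw [AEMeasurable.map_map_of_aemeasurable (by fun_prop) hm]; exact hf.map
  have e2 : (UU.map (fun y => (f y, g y))).map Prod.snd = ν := by
    rw [AEMeasurable.map_map_of_aemeasurable (by fun_prop) hm]; exact hg.map
  have := hoeff_mono π (UU.map (fun y => (f y, g y))) ξ ν h1 h2 e1 e2 (key _ h1 h2) (key _ e1 e2) ?_
  · rwa [integral_map hm (by fun_prop)] at this
  intro s t
  rw [map_measureReal_apply_of_aemeasurable hm (measurableSet_Ioi.prod measurableSet_Ioi)]
  have e : UU.real ((fun y => (f y, g y)) ⁻¹' (Ioi s ×ˢ Ioi t)) =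
      UU.real (Ioi (max (ξ.real (Iic s)) (ν.real (Iic t)))) :=
    UU_congr fun y hy => by
      have := hf y hy s
      have := hg y hy t
      simp only [mem_preimage, mem_prod, mem_Ioi, max_lt_iff]
      grind
  rw [e, UU_gt _ (le_max_of_le_left measureReal_nonneg) (max_le measureReal_le_one measureReal_le_one)]
  have c1 : π.real (Ioi s ×ˢ Ioi t) ≤ 1 - ξ.real (Iic s) := by
    have : 1 - ξ.real (Iic s) = π.real (Prod.fst ⁻¹' Ioi s) := by
      rw [← map_measureReal_apply measurable_fst measurableSet_Ioi, h1, ← compl_Iic,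
        measureReal_compl measurableSet_Iic]; simp
    rw [this]; exact measureReal_mono fun p hp => hp.1
  have c2 : π.real (Ioi s ×ˢ Ioi t) ≤ 1 - ν.real (Iic t) := by
    have : 1 - ν.real (Iic t) = π.real (Prod.snd ⁻¹' Ioi t) := by
      rw [← map_measureReal_apply measurable_snd measurableSet_Ioi, h2, ← compl_Iic,
        measureReal_compl measurableSet_Iic]; simp
    rw [this]; exact measureReal_mono fun p hp => hp.2
  rcases max_cases (ξ.real (Iic s)) (ν.real (Iic t)) with h | h <;> rw [h.1] <;> assumption

lemma gal_quantile (ξ : Measure ℝ) [IsProbabilityMeasure ξ] : Gal (quantile ξ) ξ := by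
  intro y hy x
  have hF : ∀ x, (ξ (Iic x)).toReal = cdf ξ x := fun x => (cdf_eq_real ξ x).symm
  have hne : {x : ℝ | y ≤ cdf ξ x}.Nonempty :=
    ((tendsto_cdf_atTop ξ).eventually (eventually_ge_nhds hy.2)).exists
  have hbd : BddBelow {x : ℝ | y ≤ cdf ξ x} := by
    obtain ⟨b, hb⟩ := ((tendsto_cdf_atBot ξ).eventually (eventually_lt_nhds hy.1)).exists
    refine ⟨b, fun z hz => ?_⟩
    by_contra hlt
    exact absurd (hz.trans (monotone_cdf ξ (not_le.1 hlt).le)) (not_le.2 hb)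
  simp only [quantile, hF, ← cdf_eq_real]
  refine ⟨fun h => ?_, fun h => csInf_le hbd h⟩
  have hr := ((cdf ξ).right_continuous x).mono Ioi_subset_Ici_self
  refine ge_of_tendsto hr ?_
  filter_upwards [self_mem_nhdsWithin] with z hz
  obtain ⟨w, hw, hwz⟩ := exists_lt_of_csInf_lt hne (lt_of_le_of_lt h hz)
  exact le_trans hw (monotone_cdf ξ hwz.le)

lemma gauss_cdf (x : ℝ) : (gaussianReal 0 (1/2)).real (Iic x) = (1 + erf x) / 2 := by
  have hp : gaussianPDFReal 0 (1/2) = fun t => (Real.sqrt Real.pi)⁻¹ * Real.exp (-1 * t ^ 2) := by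
    rw [gaussianPDFReal_def]; funext t
    have e1 : 2 * Real.pi * ((1/2 : NNReal) : ℝ) = Real.pi := by push_cast; ring
    have e2 : 2 * ((1/2 : NNReal) : ℝ) = 1 := by push_cast; ring
    rw [e1, e2]; simp
  have hi : Integrable (fun t : ℝ => Real.exp (-1 * t ^ 2)) := integrable_exp_neg_mul_sq one_pos
  have h0 : ∫ t in Iic (0:ℝ), Real.exp (-1 * t ^ 2) = Real.sqrt Real.pi / 2 := by
    have := integral_comp_neg_Iic (0:ℝ) (fun t => Real.exp (-1 * t ^ 2))
    simp only [neg_zero, even_two.neg_pow] at this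
    rw [this, integral_gaussian_Ioi]; simp
  have h1 := intervalIntegral.integral_Iic_sub_Iic (a := 0) (b := x) hi.integrableOn hi.integrableOn
  have hnn : 0 ≤ ∫ t in Iic x, gaussianPDFReal 0 (1/2) t :=
    integral_nonneg fun t => gaussianPDFReal_nonneg _ _ _
  have hpi : Real.sqrt Real.pi ≠ 0 := by positivity
  rw [measureReal_def, gaussianReal_apply_eq_integral _ (by norm_num), ENNReal.toReal_ofReal hnn, hp,
    integral_const_mul, eq_add_of_sub_eq h1, h0, erf]
  simp only [neg_mul, one_mul]
  field_simp
  ring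

lemma erf_hd (x : ℝ) : HasDerivAt erf ((2 / Real.sqrt Real.pi) * Real.exp (-x ^ 2)) x := by
  have hc : Continuous fun t : ℝ => Real.exp (-t ^ 2) := by fun_prop
  exact (intervalIntegral.integral_hasDerivAt_right (hc.intervalIntegrable _ _)
    hc.aestronglyMeasurable.stronglyMeasurableAtFilter hc.continuousAt).const_mul _

lemma erf_mono : StrictMono erf := by
  refine strictMono_of_deriv_pos fun x => ?_
  rw [(erf_hd x).deriv]; positivity

lemma gal_erfinv : Gal (fun y => erfinv (2 * y - 1)) (gaussianReal 0 (1/2)) := by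
  intro y hy x
  have he : ∃ a, erf a = 2 * y - 1 := by
    refine mem_range_of_exists_le_of_exists_ge
      (continuous_iff_continuousAt.2 fun x => (erf_hd x).continuousAt) ?_ ?_
    · obtain ⟨b, hb⟩ := ((tendsto_cdf_atBot (gaussianReal 0 (1/2))).eventually
        (eventually_lt_nhds hy.1)).exists
      rw [cdf_eq_real, gauss_cdf] at hb
      exact ⟨b, by linarith⟩
    · obtain ⟨b, hb⟩ := ((tendsto_cdf_atTop (gaussianReal 0 (1/2))).eventually
        (eventually_gt_nhds hy.2)).exists
      rw [cdf_eq_real, gauss_cdf] at hb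
      exact ⟨b, by linarith⟩
  have hv : erf (erfinv (2 * y - 1)) = 2 * y - 1 := Function.invFun_eq he
  rw [← erf_mono.le_iff_le, hv, gauss_cdf]
  constructor <;> intro h <;> linarith

lemma cost {ξ ν : Measure ℝ} (π : Measure (ℝ × ℝ))
    (h1 : π.map Prod.fst = ξ) (h2 : π.map Prod.snd = ν)
    (hξ : MemLp id 2 ξ) (hν : MemLp id 2 ν) :
    ∫ z, |z.1 - z.2| ^ (2:ℝ) ∂π = ∫ x, x ^ 2 ∂ξ + ∫ z, z ^ 2 ∂ν - 2 * ∫ p, p.1 * p.2 ∂π := by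
  subst h1 h2
  rw [memLp_map_measure_iff (by fun_prop) (by fun_prop)] at hξ hν
  have i1 : Integrable (fun p : ℝ × ℝ => p.1 ^ 2) π := hξ.integrable_sq
  have i2 : Integrable (fun p : ℝ × ℝ => p.2 ^ 2) π := hν.integrable_sq
  have i3 : Integrable (fun p : ℝ × ℝ => p.1 * p.2) π := hξ.integrable_mul hν
  have e : ∀ p : ℝ × ℝ, |p.1 - p.2| ^ (2:ℝ) = p.1 ^ 2 + p.2 ^ 2 - 2 * (p.1 * p.2) := fun p => by
    rw [Real.rpow_two, sq_abs]; ring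
  simp_rw [e]
  have i12 : Integrable (fun p : ℝ × ℝ => p.1 ^ 2 + p.2 ^ 2) π := i1.add i2
  rw [integral_sub i12 (i3.const_mul 2), integral_add i1 i2, integral_const_mul,
    integral_map (by fun_prop) (by fun_prop), integral_map (by fun_prop) (by fun_prop)]

/-- `W₂²(q̃, N(μ_q̃, σ²_QP)) = σ²_EP − σ²_QP`, where `σ²_EP` is the variance of `q̃`
and `σ_QP = √2 ∫₀¹ F_q̃⁻¹(y) erf⁻¹(2y − 1) dy`. -/
theorem stmt7 (qt : Measure ℝ) [IsProbabilityMeasure qt]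
    (hmom : Integrable (fun x => x ^ 2) qt) :
    let μqt : ℝ := ∫ x, x ∂qt
    let σQP : ℝ := Real.sqrt 2 * ∫ y in (0:ℝ)..1, quantile qt y * erfinv (2 * y - 1)
    Wpp 2 qt (gaussianReal μqt ((σQP ^ 2).toNNReal)) =
      ProbabilityTheory.variance id qt - σQP ^ 2 := by
  intro μ σ
  set g : ℝ → ℝ := fun y => erfinv (2 * y - 1) with hg
  set N := gaussianReal 0 (1/2) with hN
  set s := ∫ y, quantile qt y * g y ∂UU with hs
  have hσ : σ = Real.sqrt 2 * s := by
    simp only [σ, hs, hg, UU]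
    rw [intervalIntegral.integral_of_le zero_le_one, integral_Ioc_eq_integral_Ioo]
  have hσ2 : σ ^ 2 = 2 * s ^ 2 := by rw [hσ, mul_pow, Real.sq_sqrt (by norm_num)]
  have gQ := gal_quantile qt
  have gG : Gal g N := gal_erfinv
  have Lq : MemLp id 2 qt := (memLp_two_iff_integrable_sq (by fun_prop)).2 hmom
  have LN : MemLp id 2 N := memLp_id_gaussianReal 2
  have hs0 : 0 ≤ s := by
    have h := comono gQ gG (qt.prod N) (by simp [Measure.map_fst_prod])
      (by simp [Measure.map_snd_prod]) Lq LN
    rw [integral_prod_mul (fun x : ℝ => x) (fun x : ℝ => x), integral_id_gaussianReal] at h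
    simpa using h
  set ν := gaussianReal μ ((σ ^ 2).toNNReal) with hν
  have hmap : ν = N.map (fun z => μ + 2 * s * z) := by
    have : (fun z : ℝ => μ + 2 * s * z) = (fun z => μ + z) ∘ (fun z => 2 * s * z) := rfl
    rw [this, ← Measure.map_map (by fun_prop) (by fun_prop), gaussianReal_map_const_mul,
      gaussianReal_map_const_add, hν]
    congr 1
    · simp
    · ext
      rw [Real.coe_toNNReal _ (sq_nonneg _), hσ2]
      push_cast
      ring
  have Lν : MemLp id 2 ν := memLp_id_gaussianReal 2
  have hν2 : ∫ z, z ^ 2 ∂ν = μ ^ 2 + 2 * s ^ 2 := by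
    have h := variance_eq_sub Lν
    rw [variance_id_gaussianReal, Real.coe_toNNReal _ (sq_nonneg _), hσ2] at h
    simp only [Pi.pow_apply, id_eq] at h
    rw [integral_id_gaussianReal] at h
    linarith
  have hvar : variance id qt = ∫ x, x ^ 2 ∂qt - μ ^ 2 := by
    have h := variance_eq_sub Lq
    simpa using h
  have hm : AEMeasurable (fun y => (quantile qt y, μ + 2 * s * g y)) UU :=
    gQ.aem.prodMk ((gG.aem.const_mul _).const_add _)
  have Lf : MemLp (quantile qt) 2 UU := by
    have := Lq
    rw [← gQ.map, memLp_map_measure_iff (by fun_prop) gQ.aem] at this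
    exact this
  have Lg : MemLp g 2 UU := by
    have := LN
    rw [← gG.map, memLp_map_measure_iff (by fun_prop) gG.aem] at this
    exact this
  have hQμ : ∫ y, quantile qt y ∂UU = μ := by
    simp only [μ]
    conv_rhs => rw [← gQ.map]
    rw [integral_map gQ.aem (by fun_prop)]
  apply IsLeast.csInf_eq
  constructor
  · have P : IsProbabilityMeasure (UU.map (fun y => (quantile qt y, μ + 2 * s * g y))) :=
      Measure.isProbabilityMeasure_map hm
    have e1 : (UU.map (fun y => (quantile qt y, μ + 2 * s * g y))).map Prod.fst = qt := by
      rw [AEMeasurable.map_map_of_aemeasurable (by fun_prop) hm]; exact gQ.map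
    have e2 : (UU.map (fun y => (quantile qt y, μ + 2 * s * g y))).map Prod.snd = ν := by
      rw [AEMeasurable.map_map_of_aemeasurable (by fun_prop) hm, hmap, ← gG.map,
        AEMeasurable.map_map_of_aemeasurable (by fun_prop) gG.aem]; rfl
    refine ⟨_, P, e1, e2, ?_⟩
    rw [cost _ e1 e2 Lq Lν, hν2, hvar, integral_map hm (by fun_prop), hσ2]
    have : ∫ y, quantile qt y * (μ + 2 * s * g y) ∂UU = μ ^ 2 + 2 * s ^ 2 := by
      have e : ∀ y, quantile qt y * (μ + 2 * s * g y) =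
        μ * quantile qt y + 2 * s * (quantile qt y * g y) := fun y => by ring
      simp_rw [e]
      have i2 : Integrable (fun y => quantile qt y * g y) UU := Lf.integrable_mul Lg
      rw [integral_add ((Lf.integrable one_le_two).const_mul _) (i2.const_mul _),
        integral_const_mul, integral_const_mul, hQμ, ← hs]
      ring
    rw [this]; ring
  · rintro c ⟨π, hπ, h1, h2, rfl⟩
    rw [cost _ h1 h2 Lq Lν, hν2, hvar, hσ2]
    suffices h : ∫ p, p.1 * p.2 ∂π ≤ μ ^ 2 + 2 * s ^ 2 by linarith
    have hfst : ∫ p, p.1 ∂π = μ := by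
      simp only [μ]
      conv_rhs => rw [← h1]
      rw [integral_map (by fun_prop) (by fun_prop)]
    have L1 : MemLp (fun p : ℝ × ℝ => p.1) 2 π := by
      have := Lq
      rw [← h1, memLp_map_measure_iff (by fun_prop) (by fun_prop)] at this
      exact this
    have L2 : MemLp (fun p : ℝ × ℝ => p.2) 2 π := by
      have := Lν
      rw [← h2, memLp_map_measure_iff (by fun_prop) (by fun_prop)] at this
      exact this
    have i12 : Integrable (fun p : ℝ × ℝ => p.1 * p.2) π := L1.integrable_mul L2
    rcases hs0.eq_or_lt with h0 | hpos
    · have hd : ν = Measure.dirac μ := by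
        rw [hν, hσ2, ← h0]; simp
      have hae : ∀ᵐ p ∂π, p.2 = μ := by
        have : ∀ᵐ z ∂(π.map Prod.snd), z = μ := by
          rw [h2, hd, ae_dirac_eq]; simp
        exact ae_of_ae_map (by fun_prop) this
      have : ∫ p, p.1 * p.2 ∂π = ∫ p, p.1 * μ ∂π :=
        integral_congr_ae (by filter_upwards [hae] with p hp; rw [hp])
      rw [this, integral_mul_const, hfst]
      nlinarith [sq_nonneg s]
    · have hm' : Measurable (fun p : ℝ × ℝ => (p.1, (p.2 - μ) / (2 * s))) := by fun_prop
      have P : IsProbabilityMeasure (π.map (fun p : ℝ × ℝ => (p.1, (p.2 - μ) / (2 * s)))) :=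
        Measure.isProbabilityMeasure_map hm'.aemeasurable
      have e1 : (π.map (fun p : ℝ × ℝ => (p.1, (p.2 - μ) / (2 * s)))).map Prod.fst = qt := by
        rw [Measure.map_map (by fun_prop) hm']; exact h1
      have e2 : (π.map (fun p : ℝ × ℝ => (p.1, (p.2 - μ) / (2 * s)))).map Prod.snd = N := by
        rw [Measure.map_map (by fun_prop) hm']
        have : Prod.snd ∘ (fun p : ℝ × ℝ => (p.1, (p.2 - μ) / (2 * s))) =
          (fun z => (z - μ) / (2 * s)) ∘ Prod.snd := rfl
        rw [this, ← Measure.map_map (by fun_prop) (by fun_prop), h2, hmap,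
          Measure.map_map (by fun_prop) (by fun_prop)]
        have : (fun z => (z - μ) / (2 * s)) ∘ (fun z => μ + 2 * s * z) = id := by
          funext z
          simp only [Function.comp, id]
          field_simp
          ring
        rw [this, Measure.map_id]
      have h := comono gQ gG _ e1 e2 Lq LN
      rw [integral_map hm'.aemeasurable (by fun_prop), ← hs] at h
      have e : ∀ p : ℝ × ℝ, p.1 * ((p.2 - μ) / (2 * s)) =
          (2 * s)⁻¹ * (p.1 * p.2 - μ * p.1) := fun p => by field_simp
      simp only [e] at h
      rw [integral_const_mul, integral_sub i12 ((L1.integrable one_le_two).const_mul _),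
        integral_const_mul, hfst, inv_mul_le_iff₀ (by positivity)] at h
      nlinarith
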